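/- Let u(t,x) be a smooth real-valued function on ℝ² with u_x(t,x) ≠ 0 for all (t,x), and suppose u satisfies the Schwarzian KdV equation u_t = u_x · S(u) = u_xxx − (3/2)(u_xx)²/u_x. Then k := S(u) satisfies the Korteweg–de Vries equation k_t = k_xxx + 3 k k_x. -/

import Mathlib

/-- Partial derivative in the second (`x`) variable. -/
noncomputable def pdx (f : ℝ → ℝ → ℝ) : ℝ → ℝ → ℝ := fun t x => deriv (f t) x

/-- Partial derivative in the first (`t`) variable. -/
noncomputable def pdt (f : ℝ → ℝ → ℝ) : ℝ → ℝ → ℝ := fun t x => deriv (fun s => f s x) t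

/-- The Schwarzian derivative of `u(t,x)` in the `x`-variable:
`S(u) = u_xxx/u_x − (3/2)(u_xx/u_x)²`. -/
noncomputable def Schw2 (u : ℝ → ℝ → ℝ) : ℝ → ℝ → ℝ := fun t x =>
  pdx (pdx (pdx u)) t x / pdx u t x - (3/2) * (pdx (pdx u) t x / pdx u t x)^2

section PartialDerivatives

open scoped ContDiff

variable {f : ℝ → ℝ → ℝ}

theorem pdx_eq_fderiv (hf : Differentiable ℝ (Function.uncurry f)) (t x : ℝ) :
    pdx f t x = fderiv ℝ (Function.uncurry f) (t, x) (0, 1) :=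
  ((hf (t, x)).hasFDerivAt.comp_hasDerivAt x
    ((hasDerivAt_const x t).prodMk (hasDerivAt_id x))).deriv

theorem pdt_eq_fderiv (hf : Differentiable ℝ (Function.uncurry f)) (t x : ℝ) :
    pdt f t x = fderiv ℝ (Function.uncurry f) (t, x) (1, 0) :=
  ((hf (t, x)).hasFDerivAt.comp_hasDerivAt (f := fun s => (s, x)) t
    ((hasDerivAt_id t).prodMk (hasDerivAt_const t x))).deriv

theorem hasDerivAt_pdx (hf : Differentiable ℝ (Function.uncurry f)) (t x : ℝ) :
    HasDerivAt (f t) (pdx f t x) x :=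
  ((hf (t, x)).hasFDerivAt.comp_hasDerivAt x
    ((hasDerivAt_const x t).prodMk (hasDerivAt_id x))).differentiableAt.hasDerivAt

theorem hasDerivAt_pdt (hf : Differentiable ℝ (Function.uncurry f)) (t x : ℝ) :
    HasDerivAt (fun s => f s x) (pdt f t x) t :=
  ((hf (t, x)).hasFDerivAt.comp_hasDerivAt (f := fun s => (s, x)) t
    ((hasDerivAt_id t).prodMk (hasDerivAt_const t x))).differentiableAt.hasDerivAt

theorem uncurry_pdx (hf : Differentiable ℝ (Function.uncurry f)) :
    Function.uncurry (pdx f) = fun z => fderiv ℝ (Function.uncurry f) z (0, 1) :=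
  funext fun z => pdx_eq_fderiv hf z.1 z.2

theorem uncurry_pdt (hf : Differentiable ℝ (Function.uncurry f)) :
    Function.uncurry (pdt f) = fun z => fderiv ℝ (Function.uncurry f) z (1, 0) :=
  funext fun z => pdt_eq_fderiv hf z.1 z.2

theorem contDiff_pdx (hf : ContDiff ℝ ∞ (Function.uncurry f)) :
    ContDiff ℝ ∞ (Function.uncurry (pdx f)) := by
  rw [uncurry_pdx (hf.differentiable (by simp))]
  exact (hf.fderiv_right (m := ∞) (by simp)).clm_apply contDiff_const

theorem contDiff_pdt (hf : ContDiff ℝ ∞ (Function.uncurry f)) :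
    ContDiff ℝ ∞ (Function.uncurry (pdt f)) := by
  rw [uncurry_pdt (hf.differentiable (by simp))]
  exact (hf.fderiv_right (m := ∞) (by simp)).clm_apply contDiff_const

theorem pdt_pdx_comm (hf : ContDiff ℝ ∞ (Function.uncurry f)) :
    pdt (pdx f) = pdx (pdt f) := by
  have hd : Differentiable ℝ (Function.uncurry f) := hf.differentiable (by simp)
  have hd' : Differentiable ℝ (fderiv ℝ (Function.uncurry f)) :=
    (hf.fderiv_right (m := ∞) (by simp)).differentiable (by simp)
  ext t x
  rw [pdt_eq_fderiv ((contDiff_pdx hf).differentiable (by simp)),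
    pdx_eq_fderiv ((contDiff_pdt hf).differentiable (by simp)), uncurry_pdx hd, uncurry_pdt hd,
    fderiv_clm_apply (hd' _) (differentiableAt_const _),
    fderiv_clm_apply (hd' _) (differentiableAt_const _)]
  simpa using (hf.contDiffAt.isSymmSndFDerivAt
    (by simpa using WithTop.coe_le_coe.2 (le_top (a := (2 : ℕ∞))))) (1, 0) (0, 1)

end PartialDerivatives

/-- if `u_x ≠ 0` everywhere and `u` solves the Schwarzian KdV equation
`u_t = u_x · S(u) = u_xxx − (3/2)(u_xx)²/u_x`, then `k := S(u)` solves the KdV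
equation `k_t = k_xxx + 3 k k_x`. -/
theorem schwarzian_KdV_implies_KdV
    (u : ℝ → ℝ → ℝ)
    (hu : ContDiff ℝ (⊤ : ℕ∞) (Function.uncurry u))
    (hux : ∀ t x, pdx u t x ≠ 0)
    (hev : ∀ t x, pdt u t x = pdx u t x * Schw2 u t x) :
    ∀ t x, pdt (Schw2 u) t x =
      pdx (pdx (pdx (Schw2 u))) t x + 3 * Schw2 u t x * pdx (Schw2 u) t x := by
  have hdiff {f : ℝ → ℝ → ℝ} (hf : ContDiff ℝ (⊤ : ℕ∞) (Function.uncurry f)) :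
      Differentiable ℝ (Function.uncurry f) := hf.differentiable (by simp)
  -- With `a = u_x` and `w = a_x / a`, the Schwarzian is `k = w_x - w² / 2`.
  set k := Schw2 u with hk
  set a := pdx u with ha
  have sa : ContDiff ℝ (⊤ : ℕ∞) (Function.uncurry a) := contDiff_pdx hu
  have sax := contDiff_pdx sa
  set w : ℝ → ℝ → ℝ := fun t x => pdx a t x / a t x with hw
  have sw : ContDiff ℝ (⊤ : ℕ∞) (Function.uncurry w) := sax.div sa fun z => hux z.1 z.2
  have swx := contDiff_pdx sw
  have wx (t x : ℝ) : pdx w t x = pdx (pdx a) t x / a t x - w t x ^ 2 := by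
    have h0 := hux t x
    refine ((hasDerivAt_pdx (hdiff sax) t x).fun_div
      (hasDerivAt_pdx (hdiff sa) t x) h0).deriv.trans ?_
    simp only [hw]
    field_simp
  have kw : k = fun t x => pdx w t x - 1 / 2 * w t x ^ 2 := by
    ext t x
    rw [wx]
    simp only [hk, Schw2, hw, ha]
    ring
  have sk : ContDiff ℝ (⊤ : ℕ∞) (Function.uncurry k) := by
    rw [kw]
    exact swx.sub (contDiff_const.mul (sw.pow 2))
  have skx := contDiff_pdx sk
  have at_eq (t x : ℝ) : pdt a t x = pdx a t x * k t x + a t x * pdx k t x := by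
    rw [ha, pdt_pdx_comm hu, show pdt u = fun t x => a t x * k t x from funext₂ hev]
    exact ((hasDerivAt_pdx (hdiff sa) t x).fun_mul (hasDerivAt_pdx (hdiff sk) t x)).deriv
  have axt_eq (t x : ℝ) : pdt (pdx a) t x =
      pdx (pdx a) t x * k t x + 2 * pdx a t x * pdx k t x + a t x * pdx (pdx k) t x := by
    rw [pdt_pdx_comm sa, show pdt a = _ from funext₂ at_eq]
    refine (((hasDerivAt_pdx (hdiff sax) t x).fun_mul (hasDerivAt_pdx (hdiff sk) t x)).fun_add
      ((hasDerivAt_pdx (hdiff sa) t x).fun_mul (hasDerivAt_pdx (hdiff skx) t x))).deriv.trans ?_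
    ring
  have wt_eq (t x : ℝ) :
      pdt w t x = pdx w t x * k t x + w t x * pdx k t x + pdx (pdx k) t x := by
    have h0 := hux t x
    refine ((hasDerivAt_pdt (hdiff sax) t x).fun_div
      (hasDerivAt_pdt (hdiff sa) t x) h0).deriv.trans ?_
    rw [wx, axt_eq, at_eq]
    simp only [hw]
    field_simp
    ring
  have wxt_eq (t x : ℝ) : pdt (pdx w) t x = pdx (pdx w) t x * k t x
      + 2 * pdx w t x * pdx k t x + w t x * pdx (pdx k) t x + pdx (pdx (pdx k)) t x := by
    rw [pdt_pdx_comm sw, show pdt w = _ from funext₂ wt_eq]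
    refine ((((hasDerivAt_pdx (hdiff swx) t x).fun_mul (hasDerivAt_pdx (hdiff sk) t x)).fun_add
      ((hasDerivAt_pdx (hdiff sw) t x).fun_mul (hasDerivAt_pdx (hdiff skx) t x))).fun_add
      (hasDerivAt_pdx (hdiff (contDiff_pdx skx)) t x)).deriv.trans ?_
    ring
  intro t x
  have kx : pdx k t x = pdx (pdx w) t x - w t x * pdx w t x := by
    rw [kw]
    refine ((hasDerivAt_pdx (hdiff swx) t x).fun_sub
      (((hasDerivAt_pdx (hdiff sw) t x).fun_pow 2).const_mul (1 / 2))).deriv.trans ?_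
    ring
  have kt : pdt k t x = pdt (pdx w) t x - w t x * pdt w t x := by
    rw [kw]
    refine ((hasDerivAt_pdt (hdiff swx) t x).fun_sub
      (((hasDerivAt_pdt (hdiff sw) t x).fun_pow 2).const_mul (1 / 2))).deriv.trans ?_
    ring
  have kw' : k t x = pdx w t x - 1 / 2 * w t x ^ 2 := congrFun₂ kw t x
  rw [kt, wxt_eq, wt_eq]
  linear_combination (-k t x) * kx - 2 * pdx k t x * kw'
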